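/- arXiv:2106.01527 — 3 statements merged into one kernel-verified Lean document; each statement's English description precedes it below -/
import Mathlib

section
/- Let G be a finitely generated abelian group, let n ≥ 1 be an integer, and for each i ∈ ℕ let α_i : G → G and β_i : G → G be group homomorphisms with α_i ∘ β_i equal to multiplication by n. Assume n·γ = γ for every torsion element γ of G. Then the map Φ : T(G) → T(lim→(G, β_i)) sending γ to the class [γ, 0] of γ at index 0 is a well-defined group isomorphism of T(G) onto the torsion subgroup of the direct limit lim→(G, β_i). -/
/-- The composition `β (i + j - 1) ∘ ⋯ ∘ β (i + 1) ∘ β i` (with `sysMap β i 0 = id`); thus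
`sysMap β i (j - i)` is the transition map from index `i` to index `j` of the inductive system
`G →β₀ G →β₁ G →β₂ ⋯`. -/
def sysMap {G : Type*} [AddCommGroup G] (β : ℕ → G →+ G) (i : ℕ) : ℕ → (G →+ G)
  | 0 => AddMonoidHom.id G
  | j + 1 => (β (i + j)).comp (sysMap β i j)

theorem sysMap_sysMap {G : Type*} [AddCommGroup G] (β : ℕ → G →+ G) (i j k : ℕ) (x : G) :
    sysMap β (i + j) k (sysMap β i j x) = sysMap β i (j + k) x := by
  induction k with
  | zero => rfl
  | succ k ih =>
    rw [← Nat.add_assoc]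
    simp only [sysMap, AddMonoidHom.comp_apply, ih, Nat.add_assoc]

instance directedSystem_sysMap {G : Type*} [AddCommGroup G] (β : ℕ → G →+ G) :
    DirectedSystem (fun _ : ℕ => G) (fun i j _ => sysMap β i (j - i)) where
  map_self i x := by simp [sysMap]
  map_map k j i hij hjk x := by
    obtain ⟨a, rfl⟩ := Nat.exists_eq_add_of_le hij
    obtain ⟨b, rfl⟩ := Nat.exists_eq_add_of_le hjk
    have h : i + a + b - i = a + b := by omega
    simp only [Nat.add_sub_cancel_left, h]
    exact sysMap_sysMap β i a b x

theorem AddCommGroup.finite_torsion_of_fg (G : Type*) [AddCommGroup G] [AddGroup.FG G] :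
    Finite (AddCommGroup.torsion G) := by
  have : Module.Finite ℤ G := Module.Finite.iff_addGroup_fg.mpr inferInstance
  have hfin : Module.Finite ℤ (AddSubgroup.toIntSubmodule (AddCommGroup.torsion G)) :=
    inferInstance
  have : AddGroup.FG (AddCommGroup.torsion G) := Module.Finite.iff_addGroup_fg.mp hfin
  exact AddCommGroup.finite_of_fg_isAddTorsion _ AddCommMonoid.addTorsion.isAddTorsion

section

variable {G : Type*} [AddCommGroup G] {n : ℕ} {α β : ℕ → G →+ G}

theorem eq_zero_of_sysMap_eq_zero (hn : 1 ≤ n)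
    (hαβ : ∀ i : ℕ, ∀ g : G, α i (β i g) = n • g)
    (htor : ∀ γ ∈ AddCommGroup.torsion G, n • γ = γ)
    (i j : ℕ) {x : G} (hx : sysMap β i j x = 0) : x = 0 := by
  induction j with
  | zero => exact hx
  | succ j ih =>
    rw [sysMap, AddMonoidHom.comp_apply] at hx
    have h : n • sysMap β i j x = 0 := by rw [← hαβ (i + j), hx, map_zero]
    have hfin : IsOfFinAddOrder (sysMap β i j x) :=
      isOfFinAddOrder_iff_nsmul_eq_zero.mpr ⟨n, hn, h⟩
    exact ih (htor _ hfin ▸ h)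

theorem exists_torsion_sysMap_eq [AddGroup.FG G] (hn : 1 ≤ n)
    (hαβ : ∀ i : ℕ, ∀ g : G, α i (β i g) = n • g)
    (htor : ∀ γ ∈ AddCommGroup.torsion G, n • γ = γ)
    (i j : ℕ) {x : G} (hx : x ∈ AddCommGroup.torsion G) :
    ∃ t ∈ AddCommGroup.torsion G, sysMap β i j t = x := by
  have := AddCommGroup.finite_torsion_of_fg G
  let f : AddCommGroup.torsion G → AddCommGroup.torsion G :=
    fun t => ⟨sysMap β i j t, (sysMap β i j).isOfFinAddOrder t.2⟩
  have hf : Function.Injective f := fun a b hab => by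
    have h : sysMap β i j (a - b) = 0 := by
      rw [map_sub, sub_eq_zero]
      exact congrArg Subtype.val hab
    exact Subtype.ext (sub_eq_zero.mp (eq_zero_of_sysMap_eq_zero hn hαβ htor i j h))
  obtain ⟨t, ht⟩ := Finite.surjective_of_injective hf ⟨x, hx⟩
  exact ⟨t, t.2, congrArg Subtype.val ht⟩

end

/-- Let `G` be a finitely generated abelian group, `n ≥ 1`, and for each `i`
let `α i, β i : G → G` be group homomorphisms with `α i ∘ β i` equal to multiplication by `n`.
Assume `n • γ = γ` for every torsion element `γ` of `G`.  Then the map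
`Φ : T(G) → T(lim→(G, βᵢ))`, `γ ↦ [γ, 0]`, is a well-defined group isomorphism of `T(G)` onto
the torsion subgroup of the direct limit `lim→(G, βᵢ)`.  (Since `Φ` is the restriction of the
canonical group homomorphism `G → lim→(G, βᵢ)` at index `0`, this is expressed by saying that
this canonical homomorphism restricts to a bijection of `T(G)` onto `T(lim→(G, βᵢ))`.) -/
theorem stmt2 {G : Type*} [AddCommGroup G] [AddGroup.FG G]
    (n : ℕ) (hn : 1 ≤ n) (α β : ℕ → G →+ G)
    (hαβ : ∀ i : ℕ, ∀ g : G, α i (β i g) = n • g)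
    (htor : ∀ γ ∈ AddCommGroup.torsion G, n • γ = γ) :
    Set.BijOn
      (AddCommGroup.DirectLimit.of (fun _ : ℕ => G) (fun i j _ => sysMap β i (j - i)) 0)
      (AddCommGroup.torsion G : Set G)
      (AddCommGroup.torsion
        (AddCommGroup.DirectLimit (fun _ : ℕ => G) (fun i j _ => sysMap β i (j - i))) :
          Set (AddCommGroup.DirectLimit (fun _ : ℕ => G) (fun i j _ => sysMap β i (j - i)))) := by
  refine ⟨fun x hx => AddMonoidHom.isOfFinAddOrder _ hx, fun a _ b _ hab => ?_, fun z hz => ?_⟩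
  · rw [← sub_eq_zero, ← map_sub] at hab
    obtain ⟨j, _, hj⟩ := AddCommGroup.DirectLimit.of.zero_exact _ _ hab
    exact sub_eq_zero.mp (eq_zero_of_sysMap_eq_zero hn hαβ htor _ _ hj)
  · induction z using AddCommGroup.DirectLimit.induction_on with
    | ih k x =>
      obtain ⟨m, hm, hmx⟩ := isOfFinAddOrder_iff_nsmul_eq_zero.mp hz
      rw [← map_nsmul] at hmx
      obtain ⟨j, _, hj⟩ := AddCommGroup.DirectLimit.of.zero_exact _ _ hmx
      have h := eq_zero_of_sysMap_eq_zero hn hαβ htor _ _ hj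
      have hx : IsOfFinAddOrder x := isOfFinAddOrder_iff_nsmul_eq_zero.mpr ⟨m, hm, h⟩
      obtain ⟨t, ht, rfl⟩ := exists_torsion_sysMap_eq hn hαβ htor 0 (k - 0) hx
      exact ⟨t, ht, (AddCommGroup.DirectLimit.of_f
        (f := fun i j (_ : i ≤ j) => sysMap β i (j - i)) (Nat.zero_le k) t).symm⟩
end

section
/- Let G be a finitely generated abelian group, let n ≥ 1 be an integer, and for each i ∈ ℕ let α_i : G → G and β_i : G → G be group homomorphisms with α_i ∘ β_i equal to multiplication by n. Then the canonical map G ⊗_ℤ ℚ → (lim→(G, β_i)) ⊗_ℤ ℚ induced by the inclusion of G at index 0 into the direct limit is an isomorphism of ℚ-vector spaces. -/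
open TensorProduct in
/-- A homomorphism with torsion kernel becomes injective after rationalization. -/
theorem rTensor_rat_injective_of_ker_torsion {M N : Type*} [AddCommGroup M] [AddCommGroup N]
    (f : M →ₗ[ℤ] N) (hf : ∀ x, f x = 0 → ∃ m : ℕ, m ≠ 0 ∧ m • x = 0) :
    Function.Injective (f.rTensor ℚ) := by
  have hexact : Function.Exact (f.ker.subtype.rTensor ℚ) (f.rTensor ℚ) :=
    Module.Flat.rTensor_exact ℚ (LinearMap.exact_subtype_ker_map f)
  have hker : ∀ y : f.ker ⊗[ℤ] ℚ, y = 0 := by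
    intro y
    induction y using TensorProduct.induction_on with
    | zero => rfl
    | add a b ha hb => rw [ha, hb, add_zero]
    | tmul x q =>
      obtain ⟨m, hm, hmx⟩ := hf x x.2
      have hmx' : m • x = 0 := Subtype.ext hmx
      have hq : q = m • (q / m) := by
        rw [nsmul_eq_mul, mul_div_cancel₀ _ (Nat.cast_ne_zero.mpr hm)]
      rw [hq, tmul_smul, smul_tmul', hmx', zero_tmul]
  rw [injective_iff_map_eq_zero]
  intro x hx
  obtain ⟨y, rfl⟩ := (hexact x).mp hx
  rw [hker y, map_zero]

/-- On the rationalization of a finitely generated abelian group, an injective map induced by an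
endomorphism is surjective. -/
theorem rTensor_rat_surjective_of_injective {G : Type*} [AddCommGroup G] [Module.Finite ℤ G]
    (f : G →ₗ[ℤ] G) (hf : Function.Injective (f.rTensor ℚ)) :
    Function.Surjective (f.rTensor ℚ) := by
  rw [← LinearMap.lTensor_surj_iff_rTensor_surj]
  rw [← LinearMap.lTensor_inj_iff_rTensor_inj] at hf
  exact LinearMap.surjective_of_injective (f := f.baseChange ℚ) hf

theorem sysMap_add {G : Type*} [AddCommGroup G] (β : ℕ → G →+ G) (i j k : ℕ) (g : G) :
    sysMap β i (j + k) g = sysMap β (i + j) k (sysMap β i j g) := by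
  induction k with
  | zero => rfl
  | succ k ih =>
    change β (i + (j + k)) (sysMap β i (j + k) g) =
      β (i + j + k) (sysMap β (i + j) k (sysMap β i j g))
    rw [ih, add_assoc]

theorem directedSystem_sysMap_s5 {G : Type*} [AddCommGroup G] (β : ℕ → G →+ G) :
    DirectedSystem (fun _ : ℕ => G) (fun i j (_ : i ≤ j) => sysMap β i (j - i)) where
  map_self i x := by
    rw [Nat.sub_self]
    rfl
  map_map k j i hij hjk x := by
    obtain ⟨a, rfl⟩ := Nat.exists_eq_add_of_le hij
    obtain ⟨b, rfl⟩ := Nat.exists_eq_add_of_le hjk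
    rw [Nat.add_sub_cancel_left, Nat.add_sub_cancel_left, add_assoc, Nat.add_sub_cancel_left,
      sysMap_add]

theorem pow_nsmul_eq_zero_of_sysMap_eq_zero {G : Type*} [AddCommGroup G] {n : ℕ}
    {α β : ℕ → G →+ G} (hαβ : ∀ i : ℕ, ∀ g : G, α i (β i g) = n • g) (i j : ℕ) (g : G)
    (hg : sysMap β i j g = 0) : n ^ j • g = 0 := by
  induction j generalizing g with
  | zero => simpa [sysMap] using hg
  | succ j ih =>
    have h : n • sysMap β i j g = 0 := by
      rw [← hαβ (i + j), show β (i + j) (sysMap β i j g) = 0 from hg, map_zero]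
    rw [pow_succ, mul_smul]
    exact ih _ (by rw [map_nsmul, h])

/-- Let `G` be a finitely generated abelian group, `n ≥ 1`, and for each `i`
let `α i, β i : G → G` be group homomorphisms with `α i ∘ β i` equal to multiplication by `n`.
Then the canonical map `G ⊗_ℤ ℚ → (lim→(G, βᵢ)) ⊗_ℤ ℚ` induced by the inclusion of `G` at
index `0` into the direct limit is an isomorphism of `ℚ`-vector spaces (i.e. it is bijective;
it is automatically `ℚ`-linear). -/
theorem stmt5 {G : Type*} [AddCommGroup G] [AddGroup.FG G]
    (n : ℕ) (hn : 1 ≤ n) (α β : ℕ → G →+ G)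
    (hαβ : ∀ i : ℕ, ∀ g : G, α i (β i g) = n • g) :
    Function.Bijective
      (LinearMap.rTensor (R := ℤ) ℚ
        (AddCommGroup.DirectLimit.of (fun _ : ℕ => G)
          (fun i j _ => sysMap β i (j - i)) 0).toIntLinearMap) := by
  have hn0 : n ≠ 0 := Nat.one_le_iff_ne_zero.mp hn
  have := directedSystem_sysMap_s5 β
  have : Module.Finite ℤ G := Module.Finite.iff_addGroup_fg.mpr inferInstance
  constructor
  · refine rTensor_rat_injective_of_ker_torsion _ fun x hx => ?_
    obtain ⟨j, _, hj⟩ := AddCommGroup.DirectLimit.of.zero_exact (G := fun _ : ℕ => G)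
      (f := fun i j _ => sysMap β i (j - i)) 0 x hx
    exact ⟨n ^ (j - 0), pow_ne_zero _ hn0, pow_nsmul_eq_zero_of_sysMap_eq_zero hαβ 0 _ x hj⟩
  · rw [← LinearMap.range_eq_top, eq_top_iff]
    rintro y -
    induction y using TensorProduct.induction_on with
    | zero => exact zero_mem _
    | add a b ha hb => exact add_mem ha hb
    | tmul z q =>
      induction z using AddCommGroup.DirectLimit.induction_on with
      | ih k γ =>
        have hsurj := rTensor_rat_surjective_of_injective (sysMap β 0 (k - 0)).toIntLinearMap
          (rTensor_rat_injective_of_ker_torsion _ fun x hx =>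
            ⟨n ^ (k - 0), pow_ne_zero _ hn0, pow_nsmul_eq_zero_of_sysMap_eq_zero hαβ 0 _ x hx⟩)
        obtain ⟨x, hx⟩ := hsurj (γ ⊗ₜ[ℤ] q)
        refine ⟨x, ?_⟩
        let ι (i : ℕ) := (AddCommGroup.DirectLimit.of (fun _ : ℕ => G)
          (fun i j _ => sysMap β i (j - i)) i).toIntLinearMap
        have hcomp : ι k ∘ₗ (sysMap β 0 (k - 0)).toIntLinearMap = ι 0 :=
          LinearMap.ext fun g => AddCommGroup.DirectLimit.of_f (G := fun _ : ℕ => G)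
            (f := fun i j _ => sysMap β i (j - i)) (Nat.zero_le k) g
        change (ι 0).rTensor ℚ x = (ι k).rTensor ℚ (γ ⊗ₜ[ℤ] q)
        rw [← hx, ← hcomp, LinearMap.rTensor_comp_apply]
end

section
/- In the ring R, let w₃ = Σ_{1 ≤ i < j < k ≤ 9} y_i·y_j·y_k. Then w₃² ≠ 0 in R. -/
noncomputable section

/-- The generator `xⱼ` (paper-indexed, `j ∈ {1, …, 9}`) of the polynomial ring
`(ℤ/2ℤ)[x₁, …, x₉]`. -/
def Xv (j : ℕ) : MvPolynomial (Fin 9) (ZMod 2) :=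
  if h : 1 ≤ j ∧ j ≤ 9 then MvPolynomial.X ⟨j - 1, by omega⟩ else 0

/-- The ideal `I` of `(ℤ/2ℤ)[x₁, …, x₉]` generated by `x₁²`, `xⱼ² − xⱼ·xⱼ₋₁` for
`j = 2, …, 8`, and `x₉² − x₉·(x₁ + ⋯ + x₇)`. -/
def bottIdeal : Ideal (MvPolynomial (Fin 9) (ZMod 2)) :=
  Ideal.span
    ({Xv 1 ^ 2, Xv 9 ^ 2 - Xv 9 * (∑ l ∈ Finset.Icc 1 7, Xv l)} ∪
      {p | ∃ j : ℕ, 2 ≤ j ∧ j ≤ 8 ∧ p = Xv j ^ 2 - Xv j * Xv (j - 1)})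

/-- The image of `xⱼ` in the quotient ring `R = (ℤ/2ℤ)[x₁, …, x₉]/I`, the mod-2 cohomology
ring of the 9-dimensional real Bott manifold `Y(A)`. -/
def xq (j : ℕ) : MvPolynomial (Fin 9) (ZMod 2) ⧸ bottIdeal :=
  Ideal.Quotient.mk bottIdeal (Xv j)

/-- The classes `yⱼ` in `R`: `y₁ = 0`, `yⱼ = xⱼ₋₁` for `j = 2, …, 8`, and
`y₉ = x₁ + ⋯ + x₇`. -/
def yq (j : ℕ) : MvPolynomial (Fin 9) (ZMod 2) ⧸ bottIdeal :=
  if j = 9 then ∑ l ∈ Finset.Icc 1 7, xq l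
  else if 2 ≤ j ∧ j ≤ 8 then xq (j - 1) else 0

/-- An iterated quadratic extension of `ℤ/2ℤ` realising the relations `xⱼ₊₁² = xⱼ₊₁ · x_{p j}`, with
`x₀ = 0`, in which the product of the generators survives. -/
theorem exists_quadratic_tower (p : ℕ → ℕ) (hp : ∀ j, p j ≤ j) (n : ℕ) :
    ∃ (T : Type) (_ : CommRing T) (_ : ZMod 2 →+* T) (x : ℕ → T), x 0 = 0 ∧
      (∀ j < n, x (j + 1) ^ 2 = x (j + 1) * x (p j)) ∧
      ∏ j ∈ Finset.range n, x (j + 1) ≠ 0 := by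
  induction n with
  | zero => exact ⟨ZMod 2, inferInstance, RingHom.id _, 0, rfl, by simp, by simp⟩
  | succ n ih =>
    obtain ⟨T, _, f, x, hx0, hx, hprod⟩ := ih
    let ι : T →+* QuadraticAlgebra T 0 (x (p n)) := algebraMap T _
    refine ⟨_, inferInstance, ι.comp f, fun j => if j = n + 1 then ⟨0, 1⟩ else ι (x j), ?_, ?_, ?_⟩
    · simp [hx0]
    · intro j hj
      have hpj : p j ≠ n + 1 := by have := hp j; omega
      rcases Nat.lt_succ_iff_lt_or_eq.mp hj with h | rfl
      · simp [hpj, h.ne, ← map_pow, ← map_mul, hx j h]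
      · simp only [if_true, hpj, if_false, ι]
        ext <;> simp [pow_two, QuadraticAlgebra.algebraMap_eq]
    · have h : ∏ j ∈ Finset.range n, (if j + 1 = n + 1 then ⟨0, 1⟩ else ι (x (j + 1))) =
          ι (∏ j ∈ Finset.range n, x (j + 1)) := by
        rw [map_prod]
        refine Finset.prod_congr rfl fun j hj => if_neg ?_
        have := Finset.mem_range.mp hj
        omega
      simp only [Finset.prod_range_succ, h, if_true]
      intro h0
      apply hprod
      simpa [ι, -map_prod, QuadraticAlgebra.algebraMap_eq] using congrArg QuadraticAlgebra.im h0

theorem sq_esymm_eq_prod {T : Type*} [CommRing T] [CharP T 2] {a b c d e f : T}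
    (ha : a ^ 2 = 0) (hb : b ^ 2 = b * a) (hc : c ^ 2 = 0) (hd : d ^ 2 = d * c)
    (he : e ^ 2 = e * d) (hf : f ^ 2 = f * e) (y : ℕ → T)
    (h1 : y 1 = 0) (h2 : y 2 = a) (h3 : y 3 = b) (h4 : y 4 = 0) (h5 : y 5 = c) (h6 : y 6 = d)
    (h7 : y 7 = e) (h8 : y 8 = f) (h9 : y 9 = a + b + c + d + e + f) :
    (∑ i ∈ Finset.Icc 1 9, ∑ j ∈ Finset.Icc (i + 1) 9, ∑ k ∈ Finset.Icc (j + 1) 9,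
        y i * y j * y k) ^ 2 = a * b * c * d * e * f := by
  have h2T : (2 : T) = 0 := CharTwo.two_eq_zero
  simp [Finset.sum_Icc_succ_top, h1, h2, h3, h4, h5, h6, h7, h8, h9, CharTwo.add_sq, mul_pow,
    ha, hb, hc, hd, he, hf]
  grind

/-- In the ring `R = (ℤ/2ℤ)[x₁,…,x₉]/I`, with
`w₃ = Σ_{1 ≤ i < j < k ≤ 9} yᵢ·yⱼ·y_k` (the third Stiefel–Whitney class of the 9-dimensional
real Bott manifold `Y(A)`), one has `w₃² ≠ 0`. -/
theorem stmt14 :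
    (∑ i ∈ Finset.Icc 1 9, ∑ j ∈ Finset.Icc (i + 1) 9, ∑ k ∈ Finset.Icc (j + 1) 9,
        yq i * yq j * yq k) ^ 2 ≠ 0 := by
  obtain ⟨T, _, ψ, x, hx0, hx, hprod⟩ :=
    exists_quadratic_tower (fun j => if j = 2 then 0 else j) (by intro j; split <;> omega) 6
  have : Nontrivial T := ⟨_, _, hprod⟩
  have : CharP T 2 := charP_of_injective_ringHom ψ.injective 2
  let v : Fin 9 → T := ![x 1, x 2, 0, x 3, x 4, x 5, x 6, 0, 0]
  let F : MvPolynomial (Fin 9) (ZMod 2) →+* T := MvPolynomial.eval₂Hom ψ v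
  have r1 := hx 0
  have r2 := hx 1
  have r3 := hx 2
  have r4 := hx 3
  have r5 := hx 4
  have r6 := hx 5
  norm_num [hx0] at r1 r2 r3 r4 r5 r6
  have hF : ∀ p ∈ bottIdeal, F p = 0 := by
    suffices bottIdeal ≤ RingHom.ker F from fun p hp => this hp
    refine Ideal.span_le.mpr ?_
    rintro p ((rfl | rfl) | ⟨j, hj, hj', rfl⟩)
    · simp [F, v, Xv, r1]
    · simp [F, v, Xv]
    · interval_cases j <;> simp [F, v, Xv, r2, r3, r4, r5, r6]
  let φ : MvPolynomial (Fin 9) (ZMod 2) ⧸ bottIdeal →+* T := Ideal.Quotient.lift bottIdeal F hF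
  have hφ (j : ℕ) : φ (xq j) = F (Xv j) := Ideal.Quotient.lift_mk ..
  intro h
  have hw := congrArg φ h
  simp only [map_pow, map_sum, map_mul, map_zero] at hw
  rw [sq_esymm_eq_prod (a := x 1) (b := x 2) (c := x 3) (d := x 4) (e := x 5) (f := x 6)
    (by simp [r1]) r2 (by simp [r3]) r4 r5 r6 (fun j => φ (yq j))] at hw
  · exact hprod (by simpa [Finset.prod_range_succ] using hw)
  all_goals simp [yq, hφ, F, v, Xv, Finset.sum_Icc_succ_top]

end
end
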